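/- arXiv:cs/0608051 — 5 statements merged into one kernel-verified Lean document; each statement's English description precedes it below -/
import Mathlib

section
/- Let R be a monad on Type and (M, mbind) a left R-module. For f : X → R Y define comm_R f : Option X → R (Option Y) by comm_R f (some a) = bind (η ∘ some) (f a) and comm_R f none = η none. Then the derived module M' given by M' X := M (Option X) with mbind' f := mbind (comm_R f) satisfies the left R-module laws: mbind' g (mbind' f x) = mbind' (fun u => bind g (f u)) x and mbind' η x = x. -/
universe u

structure MonadOn : Type (u + 1) where
  F : Type u → Type u
  unit : ∀ X : Type u, X → F X
  bind : ∀ X Y : Type u, (X → F Y) → F X → F Y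
  bind_bind : ∀ (X Y Z : Type u) (f : X → F Y) (g : Y → F Z) (x : F X),
    bind Y Z g (bind X Y f x) = bind X Z (fun u => bind Y Z g (f u)) x
  bind_unit : ∀ (X Y : Type u) (f : X → F Y) (x : X), bind X Y f (unit X x) = f x
  unit_bind : ∀ (X : Type u) (x : F X), bind X X (unit X) x = x

/-- `comm_R f : Option X → R (Option Y)` for `f : X → R Y`. -/
def MonadOn.comm (R : MonadOn.{u}) {X Y : Type u} (f : X → R.F Y) :
    Option X → R.F (Option Y)
  | some a => R.bind Y (Option Y) (fun y => R.unit (Option Y) (some y)) (f a)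
  | none => R.unit (Option Y) none

theorem MonadOn.bind_comm_comm (R : MonadOn.{u}) {X Y Z : Type u} (f : X → R.F Y)
    (g : Y → R.F Z) (o : Option X) :
    R.bind (Option Y) (Option Z) (R.comm g) (R.comm f o) =
      R.comm (fun u => R.bind Y Z g (f u)) o := by
  cases o <;> simp only [MonadOn.comm, R.bind_bind, R.bind_unit]

theorem MonadOn.comm_unit (R : MonadOn.{u}) (X : Type u) :
    R.comm (R.unit X) = R.unit (Option X) := by
  funext o
  cases o <;> simp only [MonadOn.comm, R.bind_unit]

/-- The derived module `M' X := M (Option X)` with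
`mbind' f := mbind (comm_R f)` satisfies the left `R`-module laws. -/
theorem derived_module_is_module
    (R : MonadOn.{u})
    (M : Type u → Type u)
    (mbind : ∀ X Y : Type u, (X → R.F Y) → M X → M Y)
    (mbind_mbind : ∀ (X Y Z : Type u) (f : X → R.F Y) (g : Y → R.F Z) (x : M X),
      mbind Y Z g (mbind X Y f x) = mbind X Z (fun u => R.bind Y Z g (f u)) x)
    (unit_mbind : ∀ (X : Type u) (x : M X), mbind X X (R.unit X) x = x) :
    (∀ (X Y Z : Type u) (f : X → R.F Y) (g : Y → R.F Z) (x : M (Option X)),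
      mbind (Option Y) (Option Z) (R.comm g)
          (mbind (Option X) (Option Y) (R.comm f) x) =
        mbind (Option X) (Option Z) (R.comm (fun u => R.bind Y Z g (f u))) x) ∧
    (∀ (X : Type u) (x : M (Option X)),
      mbind (Option X) (Option X) (R.comm (R.unit X)) x = x) := by
  refine ⟨fun X Y Z f g x => ?_, fun X x => ?_⟩
  · rw [mbind_mbind]
    congr 1
    funext o
    exact R.bind_comm_comm f g o
  · rw [R.comm_unit, unit_mbind]
end

section
/- Let R be a monad on Type and (M, mbind) a left R-module. Define eval_X : M (Option X) × R X → M X by eval (m, r) := mbind (fun o => Option.elim o r? (precisely: the map sending none to r and some a to η a)) m. Then eval is an R-linear morphism from the product module M' × R (with the derived action on M' and the tautological action on R) to M: for every f : X → R Y, m : M (Option X), and r : R X, eval (mbind (comm_R f) m, bind f r) = mbind f (eval (m, r)). -/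
universe u

/-- The evaluation map
`eval (m, r) := mbind (none ↦ r, some a ↦ η a) m : M' × R → M`
is an `R`-linear morphism from the product of the derived module and the
tautological module to `M`. -/
theorem eval_is_linear
    (R : MonadOn.{u})
    (M : Type u → Type u)
    (mbind : ∀ X Y : Type u, (X → R.F Y) → M X → M Y)
    (mbind_mbind : ∀ (X Y Z : Type u) (f : X → R.F Y) (g : Y → R.F Z) (x : M X),
      mbind Y Z g (mbind X Y f x) = mbind X Z (fun u => R.bind Y Z g (f u)) x)
    (unit_mbind : ∀ (X : Type u) (x : M X), mbind X X (R.unit X) x = x)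
    (eval : ∀ X : Type u, M (Option X) × R.F X → M X)
    (heval : ∀ (X : Type u) (p : M (Option X) × R.F X),
      eval X p =
        mbind (Option X) X
          (fun o => Option.elim o p.2 (fun a => R.unit X a)) p.1) :
    ∀ (X Y : Type u) (f : X → R.F Y) (m : M (Option X)) (r : R.F X),
      eval Y (mbind (Option X) (Option Y) (R.comm f) m, R.bind X Y f r) =
        mbind X Y f (eval X (m, r)) := by
  intro X Y f m r
  rw [heval, heval, mbind_mbind, mbind_mbind]
  congr 1
  funext o
  cases o with
  | none => simp only [MonadOn.comm, R.bind_unit, Option.elim_none]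
  | some a =>
    simp only [MonadOn.comm, R.bind_bind, R.bind_unit, Option.elim_some]
    exact R.unit_bind Y (f a)
end

section
/- Let A and B be monads on Type, φ : ∀ X, A X → B X a morphism of monads, and (M, mbind_M) a left B-module. Then the base change functor commutes with derivation: for every f : X → A Y and every x : M (Option X), mbind_M (comm_B (φ ∘ f)) x = mbind_M (φ_(Option Y) ∘ comm_A f) x; that is, the derived module of the base-changed module φ*M coincides with the base change of the derived module M'. In particular φ_(Option Y) ∘ comm_A f = comm_B (φ_Y ∘ f) as maps Option X → B (Option Y). -/
universe u

/-- Base change commutes with derivation: for a morphism of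
monads `φ : A → B` and a left `B`-module `M`, the derived module of the base
change `φ*M` coincides with the base change of the derived module `M'`.
In particular `φ_(Option Y) ∘ comm_A f = comm_B (φ_Y ∘ f)`. -/
theorem base_change_commutes_with_derivation
    (A B : MonadOn.{u})
    (φ : ∀ X : Type u, A.F X → B.F X)
    (φ_unit : ∀ (X : Type u) (x : X), φ X (A.unit X x) = B.unit X x)
    (φ_bind : ∀ (X Y : Type u) (f : X → A.F Y) (x : A.F X),
      φ Y (A.bind X Y f x) = B.bind X Y (fun u => φ Y (f u)) (φ X x))
    (M : Type u → Type u)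
    (mbindM : ∀ X Y : Type u, (X → B.F Y) → M X → M Y)
    (mbindM_mbindM : ∀ (X Y Z : Type u) (f : X → B.F Y) (g : Y → B.F Z) (x : M X),
      mbindM Y Z g (mbindM X Y f x) = mbindM X Z (fun u => B.bind Y Z g (f u)) x)
    (unit_mbindM : ∀ (X : Type u) (x : M X), mbindM X X (B.unit X) x = x) :
    (∀ (X Y : Type u) (f : X → A.F Y) (x : M (Option X)),
      mbindM (Option X) (Option Y) (B.comm (fun u => φ Y (f u))) x =
        mbindM (Option X) (Option Y) (fun o => φ (Option Y) (A.comm f o)) x) ∧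
    (∀ (X Y : Type u) (f : X → A.F Y),
      (fun o => φ (Option Y) (A.comm f o)) = B.comm (fun u => φ Y (f u))) := by
  have comm_eq : ∀ (X Y : Type u) (f : X → A.F Y),
      (fun o => φ (Option Y) (A.comm f o)) = B.comm (fun u => φ Y (f u)) := by
    intro X Y f
    funext o
    cases o with
    | none => exact φ_unit _ _
    | some a => simp only [MonadOn.comm, φ_bind, φ_unit]
  exact ⟨fun X Y f x => by rw [comm_eq], comm_eq⟩
end

section
/- The syntactic λ-calculus is a monad: with unit var : X → term X and bind given by subst, the three monad laws hold: subst g (subst f x) = subst (fun u => subst g (f u)) x, subst f (var x) = f x, and subst var x = x for all x : term X. Consequently term, with pure := var and bind := subst, is a lawful monad on Type. -/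
universe u

/-- Untyped λ-terms with free variables in `X`, in the nested-datatype
(locally nameless / de Bruijn) encoding. -/
inductive term : Type u → Type (u + 1)
  | var {X : Type u} : X → term X
  | app {X : Type u} : term X → term X → term X
  | abs {X : Type u} : term (Option X) → term X

/-- Renaming of free variables. -/
def fct {X Y : Type u} (f : X → Y) : term X → term Y
  | .var x => .var (f x)
  | .app t u => .app (fct f t) (fct f u)
  | .abs t => .abs (fct (Option.map f) t)

/-- Weakening. -/
def shift {X : Type u} (t : term X) : term (Option X) :=
  fct some t

def tcomm {X Y : Type u} (f : X → term Y) : Option X → term (Option Y)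
  | some a => shift (f a)
  | none => .var none

/-- Simultaneous substitution of free variables. -/
def subst {X Y : Type u} (f : X → term Y) : term X → term Y
  | .var x => f x
  | .app t u => .app (subst f t) (subst f u)
  | .abs t => .abs (subst (tcomm f) t)

instance : Monad term.{u} where
  pure := term.var
  bind x f := subst f x

theorem fct_fct {X Y Z : Type u} (f : X → Y) (g : Y → Z) (t : term X) :
    fct g (fct f t) = fct (g ∘ f) t := by
  induction t generalizing Y Z with
  | var x => rfl
  | app t s iht ihs => simp only [fct, iht, ihs]
  | abs t ih => simp only [fct, ih, Option.map_comp_map]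

theorem fct_shift {X Y : Type u} (f : X → Y) (t : term X) :
    fct (Option.map f) (shift t) = shift (fct f t) := by
  simp only [shift, fct_fct]
  rfl

theorem subst_fct {X Y Z : Type u} (f : X → Y) (g : Y → term Z) (t : term X) :
    subst g (fct f t) = subst (g ∘ f) t := by
  induction t generalizing Y Z with
  | var x => rfl
  | app t s iht ihs => simp only [fct, subst, iht, ihs]
  | abs t ih =>
    have h : tcomm g ∘ Option.map f = tcomm (g ∘ f) := by
      funext x
      cases x <;> rfl
    simp only [fct, subst, ih, h]

theorem fct_subst {X Y Z : Type u} (f : X → term Y) (g : Y → Z) (t : term X) :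
    fct g (subst f t) = subst (fct g ∘ f) t := by
  induction t generalizing Y Z with
  | var x => rfl
  | app t s iht ihs => simp only [fct, subst, iht, ihs]
  | abs t ih =>
    have h : fct (Option.map g) ∘ tcomm f = tcomm (fct g ∘ f) := by
      funext x
      cases x with
      | none => rfl
      | some a => exact fct_shift g (f a)
    simp only [fct, subst, ih, h]

theorem subst_tcomm_shift {X Y : Type u} (f : X → term Y) (t : term X) :
    subst (tcomm f) (shift t) = shift (subst f t) := by
  simp only [shift, subst_fct, fct_subst]
  rfl

theorem subst_subst {X Y Z : Type u} (f : X → term Y) (g : Y → term Z) (t : term X) :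
    subst g (subst f t) = subst (fun x => subst g (f x)) t := by
  induction t generalizing Y Z with
  | var x => rfl
  | app t s iht ihs => simp only [subst, iht, ihs]
  | abs t ih =>
    have h : (fun x => subst (tcomm g) (tcomm f x)) = tcomm (fun x => subst g (f x)) := by
      funext x
      cases x with
      | none => rfl
      | some a => exact subst_tcomm_shift g (f a)
    simp only [subst, ih, h]

theorem tcomm_var {X : Type u} : tcomm (term.var : X → term X) = term.var := by
  funext x
  cases x <;> rfl

theorem subst_var {X : Type u} (t : term X) : subst term.var t = t := by
  induction t with
  | var x => rfl
  | app t s iht ihs => simp only [subst, iht, ihs]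
  | abs t ih => simp only [subst, tcomm_var, ih]

/-- The syntactic λ-calculus is a monad: with unit `var`
and bind `subst`, the three monad laws hold; consequently `term`, with
`pure := var` and `bind := subst`, is a lawful monad. -/
theorem term_is_monad :
    (∀ (X Y Z : Type u) (f : X → term Y) (g : Y → term Z) (x : term X),
      subst g (subst f x) = subst (fun u => subst g (f u)) x) ∧
    (∀ (X Y : Type u) (f : X → term Y) (x : X),
      subst f (term.var x) = f x) ∧
    (∀ (X : Type u) (x : term X), subst term.var x = x) ∧
    LawfulMonad term.{u} := by
  refine ⟨fun _ _ _ => subst_subst, fun _ _ _ _ => rfl, fun _ => subst_var, ?_⟩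
  exact LawfulMonad.mk' term
    (id_map := fun t => subst_var t)
    (pure_bind := fun _ _ => rfl)
    (bind_assoc := fun t f g => subst_subst f g t)
end

section
/- Initiality of the syntactic λ-calculus: let R be a monad on Type (unit η, bind satisfying the monad laws) equipped with R-linear morphisms appR : ∀ X, R X → R X → R X and absR : ∀ X, R (Option X) → R X; linearity means: for all f : X → R Y, appR (bind f s) (bind f t) = bind f (appR s t), and absR (bind (comm_R f) t) = bind f (absR t). Then there exists exactly one family φ_X : term X → R X which is a morphism of monads (φ (var x) = η x and φ (subst f x) = bind (φ ∘ f) (φ x)) and satisfies φ (app s t) = appR (φ s) (φ t) and φ (abs t) = absR (φ_(Option X) t) for all terms. (The monad LC of λ-terms is initial in the category Mon^{T₀} of monads with a representation of application and abstraction.) -/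
universe u

namespace MonadOn

variable (R : MonadOn.{u})

theorem comm_unit_s17 {X Y : Type u} (f : X → Y) :
    R.comm (fun x => R.unit Y (f x)) = fun o => R.unit (Option Y) (Option.map f o) := by
  funext o
  cases o with
  | none => rfl
  | some a => exact R.bind_unit _ _ _ _

/-- The interpretation of λ-terms in a monad with operations for application and abstraction. -/
def interp (appR : ∀ X : Type u, R.F X → R.F X → R.F X)
    (absR : ∀ X : Type u, R.F (Option X) → R.F X) : ∀ X : Type u, term X → R.F X
  | X, .var x => R.unit X x
  | X, .app s t => appR X (interp appR absR X s) (interp appR absR X t)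
  | X, .abs t => absR X (interp appR absR (Option X) t)

variable {appR : ∀ X : Type u, R.F X → R.F X → R.F X}
  {absR : ∀ X : Type u, R.F (Option X) → R.F X}

theorem interp_fct
    (appR_linear : ∀ (X Y : Type u) (f : X → R.F Y) (s t : R.F X),
      appR Y (R.bind X Y f s) (R.bind X Y f t) = R.bind X Y f (appR X s t))
    (absR_linear : ∀ (X Y : Type u) (f : X → R.F Y) (t : R.F (Option X)),
      absR Y (R.bind (Option X) (Option Y) (R.comm f) t) = R.bind X Y f (absR X t))
    {X Y : Type u} (f : X → Y) (t : term X) :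
    R.interp appR absR Y (fct f t) =
      R.bind X Y (fun x => R.unit Y (f x)) (R.interp appR absR X t) := by
  induction t generalizing Y with
  | var x => simp only [fct, interp, bind_unit]
  | app s t ihs iht => simp only [fct, interp, ihs, iht, appR_linear]
  | abs t ih => simp only [fct, interp, ih, ← absR_linear, comm_unit_s17]

theorem interp_subst
    (appR_linear : ∀ (X Y : Type u) (f : X → R.F Y) (s t : R.F X),
      appR Y (R.bind X Y f s) (R.bind X Y f t) = R.bind X Y f (appR X s t))
    (absR_linear : ∀ (X Y : Type u) (f : X → R.F Y) (t : R.F (Option X)),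
      absR Y (R.bind (Option X) (Option Y) (R.comm f) t) = R.bind X Y f (absR X t))
    {X Y : Type u} (f : X → term Y) (t : term X) :
    R.interp appR absR Y (subst f t) =
      R.bind X Y (fun x => R.interp appR absR Y (f x)) (R.interp appR absR X t) := by
  induction t generalizing Y with
  | var x => simp only [subst, interp, bind_unit]
  | app s t ihs iht => simp only [subst, interp, ihs, iht, appR_linear]
  | @abs X t ih =>
    have interp_tcomm : (fun o => R.interp appR absR (Option Y) (tcomm f o)) =
        R.comm (fun x => R.interp appR absR Y (f x)) := by
      funext o
      cases o with
      | none => rfl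
      | some a => exact R.interp_fct appR_linear absR_linear some (f a)
    simp only [subst, interp, ih, interp_tcomm, absR_linear]

end MonadOn

/-- Initiality of the syntactic λ-calculus: for any monad
`R` equipped with `R`-linear morphisms `appR : R × R → R` and
`absR : R' → R`, there is exactly one morphism of monads `φ : term → R`
commuting with application and abstraction. (The monad `LC` of λ-terms is
initial in the category `Mon^{T₀}`.) -/
theorem LC_initial
    (R : MonadOn.{u})
    (appR : ∀ X : Type u, R.F X → R.F X → R.F X)
    (absR : ∀ X : Type u, R.F (Option X) → R.F X)
    (appR_linear : ∀ (X Y : Type u) (f : X → R.F Y) (s t : R.F X),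
      appR Y (R.bind X Y f s) (R.bind X Y f t) = R.bind X Y f (appR X s t))
    (absR_linear : ∀ (X Y : Type u) (f : X → R.F Y) (t : R.F (Option X)),
      absR Y (R.bind (Option X) (Option Y) (R.comm f) t) =
        R.bind X Y f (absR X t)) :
    ∃! φ : ∀ X : Type u, term X → R.F X,
      (∀ (X : Type u) (x : X), φ X (term.var x) = R.unit X x) ∧
      (∀ (X Y : Type u) (f : X → term Y) (x : term X),
        φ Y (subst f x) = R.bind X Y (fun u => φ Y (f u)) (φ X x)) ∧
      (∀ (X : Type u) (s t : term X),
        φ X (term.app s t) = appR X (φ X s) (φ X t)) ∧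
      (∀ (X : Type u) (t : term (Option X)),
        φ X (term.abs t) = absR X (φ (Option X) t)) := by
  refine ⟨R.interp appR absR,
    ⟨fun _ _ => rfl, fun _ _ => R.interp_subst appR_linear absR_linear,
      fun _ _ _ => rfl, fun _ _ => rfl⟩, ?_⟩
  rintro φ ⟨hvar, -, happ, habs⟩
  funext X t
  induction t with
  | var x => exact hvar _ x
  | app s t ihs iht => rw [happ, ihs, iht, MonadOn.interp]
  | abs t ih => rw [habs, ih, MonadOn.interp]
end
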